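/- Let 0 < c₁ < c₂, set M := √c₂ − √c₁, and let r > 0 satisfy r > 3/√c₂ and M·r ≥ log(2·√c₂/√c₁). If moreover the second derivative of J(c₃) := D(c₁, c₃; r) + D(c₂, c₃; r) is strictly positive at every c₃ ∈ [c₁, c₂], then there exists a unique c₃* ∈ [c₁, c₂] such that J(c₃*) < J(c₃) for every c₃ ∈ [c₁, c₂] with c₃ ≠ c₃*, and this c₃* lies in the open interval (c₁, c₂). -/

import Mathlib

/-- The hyperbolic manifold distance
`D(c₁, c₃; r) = (−√c₁ + 2·√c₃·cosh((√c₃ − √c₁)·r)) / (2·√c₁·c₃)`. -/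
noncomputable def D (c₁ r c₃ : ℝ) : ℝ :=
  (-Real.sqrt c₁ + 2 * Real.sqrt c₃ * Real.cosh ((Real.sqrt c₃ - Real.sqrt c₁) * r)) /
    (2 * Real.sqrt c₁ * c₃)

theorem hasDerivAt_D {c₁ c : ℝ} (r : ℝ) (hc₁ : 0 < c₁) (hc : 0 < c) :
    HasDerivAt (D c₁ r)
      ((√c₁ + r * c * Real.sinh ((√c - √c₁) * r) - √c * Real.cosh ((√c - √c₁) * r)) /
        (2 * √c₁ * c ^ 2)) c := by
  have ha : 0 < √c₁ := Real.sqrt_pos.2 hc₁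
  have hs : 0 < √c := Real.sqrt_pos.2 hc
  have hsqrt := Real.hasDerivAt_sqrt hc.ne'
  have hnum := ((hsqrt.const_mul 2).mul ((hsqrt.sub_const √c₁).mul_const r).cosh).const_add (-√c₁)
  have hden := (hasDerivAt_id c).const_mul (2 * √c₁)
  refine (hnum.div hden (by simp only [id]; positivity)).congr_deriv ?_
  have hsq : √c ^ 2 = c := Real.sq_sqrt hc.le
  simp only [id, Pi.mul_apply]
  generalize Real.sinh ((√c - √c₁) * r) = S
  generalize Real.cosh ((√c - √c₁) * r) = C
  generalize √c = s at *
  subst hsq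
  field_simp
  ring

theorem le_cosh_of_log_two_mul_le {x q : ℝ} (hq : 0 < q) (h : Real.log (2 * q) ≤ x) :
    q ≤ Real.cosh x := by
  have hexp : 2 * q ≤ Real.exp x := (Real.log_le_iff_le_exp (by positivity)).1 h
  rw [Real.cosh_eq]
  linarith [Real.exp_pos (-x)]

theorem cosh_lt_three_mul_sinh {x : ℝ} (h : Real.log 2 ≤ x) :
    Real.cosh x < 3 * Real.sinh x := by
  have hexp : 2 ≤ Real.exp x := (Real.log_le_iff_le_exp two_pos).1 h
  have hmul : Real.exp x * Real.exp (-x) = 1 := by rw [← Real.exp_add]; simp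
  rw [Real.cosh_eq, Real.sinh_eq]
  nlinarith [Real.exp_pos (-x)]

theorem stmt_19 (c₁ c₂ r M : ℝ) (hc₁ : 0 < c₁) (hc : c₁ < c₂)
    (hM : M = Real.sqrt c₂ - Real.sqrt c₁) (hr : 0 < r)
    (hr3 : r > 3 / Real.sqrt c₂)
    (hMr : M * r ≥ Real.log (2 * Real.sqrt c₂ / Real.sqrt c₁))
    (hconv : ∀ c₃ ∈ Set.Icc c₁ c₂,
      0 < deriv (deriv (fun c₃ => D c₁ r c₃ + D c₂ r c₃)) c₃) :
    ∃! c₃star : ℝ, c₃star ∈ Set.Icc c₁ c₂ ∧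
      (∀ c₃ ∈ Set.Icc c₁ c₂, c₃ ≠ c₃star →
        D c₁ r c₃star + D c₂ r c₃star < D c₁ r c₃ + D c₂ r c₃) ∧
      c₃star ∈ Set.Ioo c₁ c₂ := by
  have hc₂ : 0 < c₂ := hc₁.trans hc
  have ha : 0 < √c₁ := Real.sqrt_pos.2 hc₁
  have hb : 0 < √c₂ := Real.sqrt_pos.2 hc₂
  have hab : √c₁ < √c₂ := Real.sqrt_lt_sqrt hc₁.le hc
  have hx : 0 < M * r := mul_pos (by linarith) hr
  have hS : 0 < Real.sinh (M * r) := Real.sinh_pos_iff.2 hx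
  have hC : √c₂ ≤ √c₁ * Real.cosh (M * r) := by
    have := le_cosh_of_log_two_mul_le (x := M * r) (div_pos hb ha) (by rwa [← mul_div_assoc])
    rwa [div_le_iff₀' ha] at this
  have hCS : Real.cosh (M * r) < 3 * Real.sinh (M * r) := by
    refine cosh_lt_three_mul_sinh (le_trans (Real.log_le_log two_pos ?_) hMr)
    rw [le_div_iff₀ ha]
    linarith
  have hrb : 3 < r * √c₂ := (div_lt_iff₀ hb).1 hr3
  set J : ℝ → ℝ := fun c₃ => D c₁ r c₃ + D c₂ r c₃
  have hadd {c : ℝ} (hpos : 0 < c) : HasDerivAt J _ c :=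
    (hasDerivAt_D r hc₁ hpos).add (hasDerivAt_D r hc₂ hpos)
  have hderiv : ∀ c ∈ Set.Icc c₁ c₂, HasDerivAt J (deriv J c) c := fun c hmem =>
    (hadd (hc₁.trans_le hmem.1)).differentiableAt.hasDerivAt
  have hleft : deriv J c₁ < 0 := by
    rw [(hadd hc₁).deriv,
      show (√c₁ - √c₂) * r = -(M * r) by rw [hM]; ring, Real.sinh_neg, Real.cosh_neg]
    simp only [sub_self, zero_mul, Real.sinh_zero, Real.cosh_zero, mul_zero, mul_one, add_zero,
      zero_div, zero_add]
    refine div_neg_of_neg_of_pos ?_ (by positivity)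
    have : 0 < r * c₁ * Real.sinh (M * r) := by positivity
    linarith
  have hright : 0 < deriv J c₂ := by
    rw [(hadd hc₂).deriv, ← hM]
    simp only [sub_self, zero_mul, Real.sinh_zero, Real.cosh_zero, mul_zero, mul_one, add_zero,
      zero_div]
    refine div_pos ?_ (by positivity)
    have h₁ : √c₂ * Real.cosh (M * r) < √c₂ * (r * √c₂ * Real.sinh (M * r)) := by
      gcongr
      exact hCS.trans (by gcongr)
    have h₂ : √c₂ * (r * √c₂ * Real.sinh (M * r)) = r * c₂ * Real.sinh (M * r) := by
      linear_combination r * Real.sinh (M * r) * Real.sq_sqrt hc₂.le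
    linarith
  have hconvex : StrictConvexOn ℝ (Set.Icc c₁ c₂) J :=
    strictConvexOn_of_deriv2_pos' (convex_Icc c₁ c₂)
      (fun c hmem => (hderiv c hmem).continuousAt.continuousWithinAt) hconv
  obtain ⟨c, hmem, hzero⟩ := exists_hasDerivWithinAt_eq_of_gt_of_lt hc.le
    (fun c hmem => (hderiv c hmem).hasDerivWithinAt) hleft hright
  have hmem' := Set.Ioo_subset_Icc_self hmem
  have hcrit : HasDerivAt J 0 c := hzero ▸ hderiv c hmem'
  have hmin : ∀ y ∈ Set.Icc c₁ c₂, y ≠ c → J c < J y := by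
    intro y hy hne
    rcases hne.lt_or_gt with h | h
    · have := hconvex.slope_lt_of_hasDerivAt hy hmem' h hcrit
      rw [slope_def_field, div_lt_iff₀ (by linarith)] at this
      linarith
    · have := hconvex.lt_slope_of_hasDerivAt hmem' hy h hcrit
      rw [slope_def_field, lt_div_iff₀ (by linarith)] at this
      linarith
  refine ⟨c, ⟨hmem', hmin, hmem⟩, ?_⟩
  rintro y ⟨hy, hymin, -⟩
  by_contra hne
  exact lt_asymm (hmin y hy hne) (hymin c hmem' (Ne.symm hne))
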